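/- Gâteaux derivative of the fractional cost functional: let a < b, d, m positive integers, 0 < α ≤ 1, A ∈ ℝ^d, f : ℝ^d × ℝ^m × [a,b] → ℝ^d of class C² satisfying ‖f(x₁,v,t) - f(x₂,v,t)‖ ≤ M ‖x₁ - x₂‖ for some M ≥ 0, and L : ℝ^d × ℝ^m × [a,b] → ℝ of class C². Let u, ū : [a,b] → ℝ^m be continuous, let Q : ℝ → ([a,b] → ℝ^d) be such that for every ε, Q(ε) is continuous and satisfies Q(ε)(t) = A + I^α_-(s ↦ f(Q(ε)(s), u(s) + ε ū(s), s))(t) for all t ∈ [a,b], and let q̄ be the continuous function satisfying q̄(t) = I^α_-(s ↦ (∂f/∂x)(Q(0)(s), u(s), s) · q̄(s) + (∂f/∂v)(Q(0)(s), u(s), s) · ū(s))(t) for all t. Then lim_{ε→0} (1/ε) [∫_a^b L(Q(ε)(t), u(t) + ε ū(t), t) dt - ∫_a^b L(Q(0)(t), u(t), t) dt] = ∫_a^b [(∂L/∂x)(Q(0)(t), u(t), t) · q̄(t) + (∂L/∂v)(Q(0)(t), u(t), t) · ū(t)] dt. -/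

import Mathlib

open Set Filter Topology MeasureTheory RealInnerProductSpace

/-- Left Riemann–Liouville fractional integral of order `α` with inferior limit `a`.
(At `t = a` the integral vanishes, so `Ileft a α g a = 0`.) -/
noncomputable def Ileft {E : Type*} [NormedAddCommGroup E] [NormedSpace ℝ E]
    (a α : ℝ) (g : ℝ → E) (t : ℝ) : E :=
  (Real.Gamma α)⁻¹ • ∫ y in a..t, (t - y) ^ (α - 1) • g y

/-- Right Riemann–Liouville fractional integral of order `α` with superior limit `b`.
(At `t = b` the integral vanishes, so `Iright b α g b = 0`.) -/
noncomputable def Iright {E : Type*} [NormedAddCommGroup E] [NormedSpace ℝ E]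
    (b α : ℝ) (g : ℝ → E) (t : ℝ) : E :=
  (Real.Gamma α)⁻¹ • ∫ y in t..b, (y - t) ^ (α - 1) • g y

section FractionalIntegral

variable {E : Type*} [NormedAddCommGroup E] [NormedSpace ℝ E] {a t α : ℝ} {g h : ℝ → E}

lemma intervalIntegrable_sub_rpow_smul (hα : 0 < α) (hat : a ≤ t) (hg : ContinuousOn g (Icc a t)) :
    IntervalIntegrable (fun y => (t - y) ^ (α - 1) • g y) volume a t := by
  have hk : IntervalIntegrable (fun y : ℝ => (t - y) ^ (α - 1)) volume a t := by
    have := (intervalIntegral.intervalIntegrable_rpow' (a := t - a) (b := 0)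
      (r := α - 1) (by linarith)).comp_sub_left t
    simpa using this
  exact hk.smul_continuousOn (by rwa [uIcc_of_le hat])

lemma Ileft_sub (hα : 0 < α) (hat : a ≤ t) (hg : ContinuousOn g (Icc a t))
    (hh : ContinuousOn h (Icc a t)) :
    Ileft a α (fun s => g s - h s) t = Ileft a α g t - Ileft a α h t := by
  simp only [Ileft, smul_sub]
  rw [intervalIntegral.integral_sub (intervalIntegrable_sub_rpow_smul hα hat hg)
    (intervalIntegrable_sub_rpow_smul hα hat hh), smul_sub]

lemma Ileft_const_smul (c : ℝ) : Ileft a α (fun s => c • g s) t = c • Ileft a α g t := by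
  simp only [Ileft, smul_comm _ c, intervalIntegral.integral_smul]

lemma norm_Ileft_le {φ : ℝ → ℝ} (hα : 0 < α) (hat : a ≤ t) (hφ : ContinuousOn φ (Icc a t))
    (hle : ∀ s ∈ Icc a t, ‖g s‖ ≤ φ s) : ‖Ileft a α g t‖ ≤ Ileft a α φ t := by
  rw [Ileft, Ileft, norm_smul, Real.norm_of_nonneg (inv_nonneg.2 (Real.Gamma_pos_of_pos hα).le),
    smul_eq_mul]
  refine mul_le_mul_of_nonneg_left ?_ (inv_nonneg.2 (Real.Gamma_pos_of_pos hα).le)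
  refine intervalIntegral.norm_integral_le_of_norm_le hat (.of_forall fun s hs => ?_)
    (intervalIntegrable_sub_rpow_smul hα hat hφ)
  have hk : 0 ≤ (t - s) ^ (α - 1) := Real.rpow_nonneg (sub_nonneg.2 hs.2) _
  rw [norm_smul, Real.norm_of_nonneg hk, smul_eq_mul]
  exact mul_le_mul_of_nonneg_left (hle s (Ioc_subset_Icc_self hs)) hk

lemma Ileft_exp_le {r : ℝ} (hα : 0 < α) (hr : 0 < r) (hat : a ≤ t) :
    Ileft a α (fun s => Real.exp (r * (s - a))) t ≤ (1 / r) ^ α * Real.exp (r * (t - a)) := by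
  have hΓ := Real.Gamma_pos_of_pos hα
  have hint : IntegrableOn (fun y : ℝ => y ^ (α - 1) * Real.exp (-(r * y))) (Ioi 0) := by
    simpa using integrableOn_rpow_mul_exp_neg_mul_rpow (s := α - 1) (p := 1) (by linarith)
      one_pos hr
  have hle : ∫ y in (0 : ℝ)..t - a, y ^ (α - 1) * Real.exp (-(r * y)) ≤
      (1 / r) ^ α * Real.Gamma α := by
    rw [← Real.integral_rpow_mul_exp_neg_mul_Ioi hα hr,
      intervalIntegral.integral_of_le (sub_nonneg.2 hat)]
    refine setIntegral_mono_set hint ?_ (Ioc_subset_Ioi_self.eventuallyLE)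
    filter_upwards [ae_restrict_mem measurableSet_Ioi] with y hy
    have : (0 : ℝ) < y := hy
    positivity
  have hsub : ∫ y in a..t, (t - y) ^ (α - 1) * Real.exp (r * (y - a)) =
      Real.exp (r * (t - a)) * ∫ y in (0 : ℝ)..t - a, y ^ (α - 1) * Real.exp (-(r * y)) := by
    have := intervalIntegral.integral_comp_sub_left (a := a) (b := t)
      (fun y : ℝ => y ^ (α - 1) * Real.exp (-(r * y))) t
    rw [sub_self] at this
    rw [← this, ← intervalIntegral.integral_const_mul]
    congr 1 with y
    rw [mul_left_comm, ← Real.exp_add]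
    ring_nf
  simp only [Ileft, smul_eq_mul, hsub]
  calc _ ≤ (Real.Gamma α)⁻¹ * (Real.exp (r * (t - a)) * ((1 / r) ^ α * Real.Gamma α)) := by gcongr
    _ = _ := by field_simp

/-- Fractional Grönwall inequality. -/
lemma exists_fractional_gronwall (a b : ℝ) {α M : ℝ} (hα : 0 < α) (hM : 0 ≤ M) :
    ∃ C > 0, ∀ (φ : ℝ → ℝ) (c : ℝ), 0 ≤ c → ContinuousOn φ (Icc a b) →
      (∀ t ∈ Icc a b, 0 ≤ φ t) →
      (∀ t ∈ Icc a b, φ t ≤ Ileft a α (fun s => M * φ s + c) t) →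
      ∀ t ∈ Icc a b, φ t ≤ C * c := by
  obtain ⟨r, hr, hrα⟩ : ∃ r : ℝ, 0 < r ∧ (1 / r) ^ α = (M + 1)⁻¹ := by
    refine ⟨(M + 1) ^ α⁻¹, by positivity, ?_⟩
    rw [Real.div_rpow zero_le_one (by positivity), Real.one_rpow,
      Real.rpow_inv_rpow (by positivity) hα.ne', one_div]
  refine ⟨Real.exp (r * (b - a)), Real.exp_pos _, fun φ c hc hφc hφ0 hφ t ht => ?_⟩
  obtain ⟨t₀, ht₀, hmax⟩ := isCompact_Icc.exists_isMaxOn ⟨t, ht⟩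
    (f := fun s => φ s * Real.exp (-(r * (s - a)))) (by fun_prop)
  set m := φ t₀ * Real.exp (-(r * (t₀ - a))) with hm
  have hm0 : 0 ≤ m := mul_nonneg (hφ0 t₀ ht₀) (Real.exp_pos _).le
  have hbound : ∀ s ∈ Icc a b, φ s ≤ m * Real.exp (r * (s - a)) := fun s hs => by
    have h1 : φ s * Real.exp (-(r * (s - a))) ≤ m := hmax hs
    rwa [Real.exp_neg, ← div_eq_mul_inv, div_le_iff₀ (Real.exp_pos _)] at h1
  have key : φ t₀ ≤ (M * m + c) * ((M + 1)⁻¹ * Real.exp (r * (t₀ - a))) := by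
    have hsub : Icc a t₀ ⊆ Icc a b := Icc_subset_Icc_right ht₀.2
    calc φ t₀ ≤ ‖Ileft a α (fun s => M * φ s + c) t₀‖ :=
          (hφ t₀ ht₀).trans (Real.le_norm_self _)
      _ ≤ Ileft a α (fun s => (M * m + c) • Real.exp (r * (s - a))) t₀ := by
          refine norm_Ileft_le hα ht₀.1 (by fun_prop) fun s hs => ?_
          have h0 := hφ0 s (hsub hs)
          rw [Real.norm_of_nonneg (by positivity), smul_eq_mul, add_mul, mul_assoc]
          have h1 : 1 ≤ Real.exp (r * (s - a)) :=
            Real.one_le_exp (mul_nonneg hr.le (sub_nonneg.2 hs.1))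
          exact add_le_add (mul_le_mul_of_nonneg_left (hbound s (hsub hs)) hM)
            (le_mul_of_one_le_right hc h1)
      _ = (M * m + c) * Ileft a α (fun s => Real.exp (r * (s - a))) t₀ := Ileft_const_smul _
      _ ≤ _ := by
          rw [← hrα]
          exact mul_le_mul_of_nonneg_left (Ileft_exp_le hα hr ht₀.1) (by positivity)
  have hmc : m ≤ c := by
    have : m ≤ (M * m + c) * (M + 1)⁻¹ := by
      rw [← mul_assoc, ← div_le_iff₀ (Real.exp_pos _), div_eq_mul_inv, ← Real.exp_neg] at key
      exact key
    rw [← div_eq_mul_inv, le_div_iff₀ (by positivity)] at this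
    linarith
  calc φ t ≤ m * Real.exp (r * (t - a)) := hbound t ht
    _ ≤ c * Real.exp (r * (b - a)) := by
        have := ht.2
        gcongr
    _ = _ := mul_comm _ _

end FractionalIntegral

section Linearization

lemma continuousOn_comp_curve {X V Y : Type*} [TopologicalSpace X] [TopologicalSpace V]
    [TopologicalSpace Y] {F : X → V → ℝ → Y} {a b : ℝ} {x : ℝ → X} {v : ℝ → V}
    (hF : ContinuousOn (fun p : X × V × ℝ => F p.1 p.2.1 p.2.2) (univ ×ˢ univ ×ˢ Icc a b))
    (hx : ContinuousOn x (Icc a b)) (hv : ContinuousOn v (Icc a b)) :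
    ContinuousOn (fun t => F (x t) (v t) t) (Icc a b) :=
  hF.comp (f := fun t => (x t, v t, t)) (hx.prodMk (hv.prodMk continuousOn_id))
    fun _ ht => ⟨trivial, trivial, ht⟩

variable {X V Y : Type*} [NormedAddCommGroup X] [NormedSpace ℝ X] [NormedAddCommGroup V]
  [NormedSpace ℝ V] [NormedAddCommGroup Y] [NormedSpace ℝ Y]

lemma fderivWithin_apply_eq_add_partial {F : X → V → ℝ → Y} {T : Set ℝ} {x : X} {v : V} {t : ℝ}
    (ht : t ∈ T)
    (hF : DifferentiableWithinAt ℝ (fun p : X × V × ℝ => F p.1 p.2.1 p.2.2)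
      (univ ×ˢ univ ×ˢ T) (x, v, t))
    {Fx : X →L[ℝ] Y} {Fv : V →L[ℝ] Y} (hFx : HasFDerivAt (fun y => F y v t) Fx x)
    (hFv : HasFDerivAt (fun w => F x w t) Fv v) (p : X) (q : V) :
    fderivWithin ℝ (fun p : X × V × ℝ => F p.1 p.2.1 p.2.2) (univ ×ˢ univ ×ˢ T) (x, v, t)
      (p, q, 0) = Fx p + Fv q := by
  have hD := hF.hasFDerivWithinAt
  set D := fderivWithin ℝ (fun p : X × V × ℝ => F p.1 p.2.1 p.2.2) (univ ×ˢ univ ×ˢ T) (x, v, t)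
  have h1 : HasFDerivAt (fun y : X => F y v t)
      (D.comp ((ContinuousLinearMap.id ℝ X).prod 0)) x := by
    rw [← hasFDerivWithinAt_univ]
    exact hD.comp x (f := fun y : X => (y, v, t))
      ((hasFDerivAt_id x).prodMk (hasFDerivAt_const (v, t) x)).hasFDerivWithinAt
      fun y _ => ⟨trivial, trivial, ht⟩
  have h2 : HasFDerivAt (fun w : V => F x w t)
      (D.comp ((0 : V →L[ℝ] X).prod ((ContinuousLinearMap.id ℝ V).prod 0))) v := by
    rw [← hasFDerivWithinAt_univ]
    exact hD.comp v (f := fun w : V => (x, w, t))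
      ((hasFDerivAt_const x v).prodMk
        ((hasFDerivAt_id v).prodMk (hasFDerivAt_const t v))).hasFDerivWithinAt
      fun y _ => ⟨trivial, trivial, ht⟩
  rw [hFx.unique h1, hFv.unique h2]
  simp [← map_add]

variable {F : X → V → ℝ → Y} {Fx : X → V → ℝ → X →L[ℝ] Y} {Fv : X → V → ℝ → V →L[ℝ] Y} {a b : ℝ}
  {x p : ℝ → X} {v q : ℝ → V}

lemma uniqueDiffOn_univ_prod_univ_prod_Icc (hab : a < b) :
    UniqueDiffOn ℝ ((univ : Set X) ×ˢ (univ : Set V) ×ˢ Icc a b) :=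
  uniqueDiffOn_univ.prod (uniqueDiffOn_univ.prod (uniqueDiffOn_Icc hab))

lemma continuousOn_partial_apply_add (hab : a < b)
    (hF : ContDiffOn ℝ 1 (fun p : X × V × ℝ => F p.1 p.2.1 p.2.2) (univ ×ˢ univ ×ˢ Icc a b))
    (hFx : ∀ x v, ∀ t ∈ Icc a b, HasFDerivAt (fun y => F y v t) (Fx x v t) x)
    (hFv : ∀ x v, ∀ t ∈ Icc a b, HasFDerivAt (fun w => F x w t) (Fv x v t) v)
    (hx : ContinuousOn x (Icc a b)) (hv : ContinuousOn v (Icc a b))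
    (hp : ContinuousOn p (Icc a b)) (hq : ContinuousOn q (Icc a b)) :
    ContinuousOn (fun t => Fx (x t) (v t) t (p t) + Fv (x t) (v t) t (q t)) (Icc a b) := by
  have hD := (hF.continuousOn_fderivWithin (uniqueDiffOn_univ_prod_univ_prod_Icc hab) le_rfl).comp
    (f := fun t => (x t, v t, t)) (hx.prodMk (hv.prodMk continuousOn_id))
    (fun _ ht => ⟨trivial, trivial, ht⟩)
  refine (hD.clm_apply (hp.prodMk (hq.prodMk (continuousOn_const (c := (0 : ℝ)))))).congr
    fun t ht => ?_
  exact (fderivWithin_apply_eq_add_partial ht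
    (hF.differentiableOn one_ne_zero _ ⟨trivial, trivial, ht⟩) (hFx _ _ t ht) (hFv _ _ t ht) _ _).symm

/-- First-order expansion of a `C¹` function along a perturbed curve, uniformly in time. -/
lemma eventually_norm_sub_linearization_le [ProperSpace X] [ProperSpace V] (hab : a < b)
    (hF : ContDiffOn ℝ 1 (fun p : X × V × ℝ => F p.1 p.2.1 p.2.2) (univ ×ˢ univ ×ˢ Icc a b))
    (hFx : ∀ x v, ∀ t ∈ Icc a b, HasFDerivAt (fun y => F y v t) (Fx x v t) x)
    (hFv : ∀ x v, ∀ t ∈ Icc a b, HasFDerivAt (fun w => F x w t) (Fv x v t) v)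
    (hx : ContinuousOn x (Icc a b)) (hv : ContinuousOn v (Icc a b))
    (hp : ContinuousOn p (Icc a b)) (hq : ContinuousOn q (Icc a b)) {z : ℝ → ℝ → X}
    (hz : ∀ η > 0, ∀ᶠ ε in 𝓝 (0 : ℝ), ∀ t ∈ Icc a b, ‖z ε t - x t - ε • p t‖ ≤ η * |ε|)
    {η : ℝ} (hη : 0 < η) :
    ∀ᶠ ε in 𝓝 (0 : ℝ), ∀ t ∈ Icc a b,
      ‖F (z ε t) (v t + ε • q t) t - F (x t) (v t) t -
        ε • (Fx (x t) (v t) t (p t) + Fv (x t) (v t) t (q t))‖ ≤ η * |ε| := by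
  obtain ⟨R, hR⟩ := isCompact_Icc.exists_bound_of_continuousOn (hx.prodMk hv)
  obtain ⟨B, hB⟩ := isCompact_Icc.exists_bound_of_continuousOn (hp.prodMk hq)
  have hB0 : 0 ≤ B := (norm_nonneg _).trans (hB a (left_mem_Icc.2 hab.le))
  set K : Set (X × V × ℝ) :=
    Metric.closedBall 0 (R + 1) ×ˢ Metric.closedBall 0 (R + 1) ×ˢ Icc a b with hK
  have hKc : IsCompact K := (isCompact_closedBall _ _).prod
    ((isCompact_closedBall _ _).prod isCompact_Icc)
  have hKconv : Convex ℝ K := (convex_closedBall _ _).prod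
    ((convex_closedBall _ _).prod (convex_Icc a b))
  have hKS : K ⊆ univ ×ˢ univ ×ˢ Icc a b := fun y hy => ⟨trivial, trivial, hy.2.2⟩
  set D := fderivWithin ℝ (fun p : X × V × ℝ => F p.1 p.2.1 p.2.2) (univ ×ˢ univ ×ˢ Icc a b)
    with hD
  have hDc : ContinuousOn D K :=
    (hF.continuousOn_fderivWithin (uniqueDiffOn_univ_prod_univ_prod_Icc hab) le_rfl).mono hKS
  obtain ⟨C, hC⟩ := hKc.exists_bound_of_continuousOn hDc
  have hmem : ∀ t ∈ Icc a b, (x t, v t, t) ∈ K := fun t ht => by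
    have := norm_prod_le_iff.1 (hR t ht)
    simp only [hK, mem_prod, mem_closedBall_zero_iff]
    exact ⟨by linarith [this.1], by linarith [this.2], ht⟩
  have hC0 : 0 ≤ C := (norm_nonneg _).trans (hC _ (hmem a (left_mem_Icc.2 hab.le)))
  set η₁ := min 1 (η / (B + 1 + C)) with hη₁
  have hη₁0 : 0 < η₁ := lt_min one_pos (by positivity)
  have hη₁1 : η₁ ≤ 1 := min_le_left _ _
  have hη₁η : η₁ * (B + 1 + C) ≤ η := by
    rw [← le_div_iff₀ (by positivity)]
    exact min_le_right _ _
  obtain ⟨δ, hδ0, hδ⟩ := Metric.uniformContinuousOn_iff.1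
    (hKc.uniformContinuousOn_of_continuous hDc) η₁ hη₁0
  have hsmall : ∀ᶠ ε in 𝓝 (0 : ℝ), |ε| * (B + 1) < min 1 δ := by
    have : Tendsto (fun ε : ℝ => |ε| * (B + 1)) (𝓝 0) (𝓝 0) := by
      have h : Continuous fun ε : ℝ => |ε| * (B + 1) := by fun_prop
      simpa using h.tendsto 0
    exact this.eventually_lt_const (lt_min one_pos hδ0)
  filter_upwards [hsmall, hz η₁ hη₁0] with ε hε hzε t ht
  have hx' := hzε t ht
  obtain ⟨hpB, hqB⟩ := norm_prod_le_iff.1 (hB t ht)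
  obtain ⟨hxR, hvR⟩ := norm_prod_le_iff.1 (hR t ht)
  simp only at hpB hqB hxR hvR
  have hzx : ‖z ε t - x t‖ ≤ |ε| * (B + 1) :=
    calc ‖z ε t - x t‖ = ‖(z ε t - x t - ε • p t) + ε • p t‖ := by rw [sub_add_cancel]
      _ ≤ η₁ * |ε| + |ε| * B := by
          refine (norm_add_le _ _).trans (add_le_add hx' ?_)
          rw [norm_smul, Real.norm_eq_abs]
          gcongr
      _ ≤ _ := by nlinarith [abs_nonneg ε]
  have hqε : ‖ε • q t‖ ≤ |ε| * (B + 1) := by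
    rw [norm_smul, Real.norm_eq_abs]
    gcongr
    linarith
  set P : X × V × ℝ := (x t, v t, t) with hP
  set P' : X × V × ℝ := (z ε t, v t + ε • q t, t) with hP'
  have hdiff : P' - P = (z ε t - x t, ε • q t, 0) := by simp [hP, hP']
  have hnorm : ‖P' - P‖ ≤ |ε| * (B + 1) := by
    rw [hdiff, norm_prod_le_iff, norm_prod_le_iff]
    exact ⟨hzx, hqε, by simpa using by positivity⟩
  have hP'K : P' ∈ K := by
    simp only [hK, hP', mem_prod, mem_closedBall_zero_iff]
    have h1 := hε.trans_le (min_le_left _ _)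
    refine ⟨?_, ?_, ht⟩
    · have := norm_add_le (z ε t - x t) (x t)
      rw [sub_add_cancel] at this
      linarith
    · linarith [norm_add_le (v t) (ε • q t)]
  have hmv : ‖F (z ε t) (v t + ε • q t) t - F (x t) (v t) t - D P (P' - P)‖ ≤
      η₁ * ‖P' - P‖ := by
    refine Convex.norm_image_sub_le_of_norm_hasFDerivWithin_le'
      (f := fun p : X × V × ℝ => F p.1 p.2.1 p.2.2) (f' := D) (s := K ∩ Metric.ball P δ)
      (x := P) (y := P') (fun y hy => ?_) (fun y hy => ?_) (hKconv.inter (convex_ball _ _))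
      ⟨hmem t ht, Metric.mem_ball_self hδ0⟩ ⟨hP'K, ?_⟩
    · exact (hF.differentiableOn one_ne_zero y (hKS hy.1)).hasFDerivWithinAt.mono
        (inter_subset_left.trans hKS)
    · rw [← dist_eq_norm]
      exact (hδ y hy.1 P (hmem t ht) hy.2).le
    · rw [Metric.mem_ball, dist_eq_norm]
      exact hnorm.trans_lt (hε.trans_le (min_le_right _ _))
  have hDP : D P (P' - P) = D P (z ε t - x t - ε • p t, 0, 0) +
      ε • (Fx (x t) (v t) t (p t) + Fv (x t) (v t) t (q t)) := by
    rw [← fderivWithin_apply_eq_add_partial ht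
      (hF.differentiableOn one_ne_zero _ ⟨trivial, trivial, ht⟩) (hFx _ _ t ht) (hFv _ _ t ht)
      (p t) (q t), ← map_smul, ← map_add, hdiff]
    simp
  calc _ = ‖(F (z ε t) (v t + ε • q t) t - F (x t) (v t) t - D P (P' - P)) +
        D P (z ε t - x t - ε • p t, 0, 0)‖ := by rw [hDP]; congr 1; abel
    _ ≤ η₁ * (|ε| * (B + 1)) + C * (η₁ * |ε|) := by
        refine (norm_add_le _ _).trans (add_le_add (hmv.trans (by gcongr)) ?_)
        refine ((D P).le_opNorm _).trans ?_
        gcongr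
        · exact hC P (hmem t ht)
        · rw [norm_prod_le_iff]
          exact ⟨hx', by simpa using by positivity⟩
    _ = η₁ * (B + 1 + C) * |ε| := by ring
    _ ≤ η * |ε| := by gcongr

end Linearization

/-- Gâteaux derivative of the fractional cost functional:
`Dℒ^α(u)(ū) = ∫_a^b (∂L/∂x)(q^{u,α},u,t)·q̄ + (∂L/∂v)(q^{u,α},u,t)·ū dt`. -/
theorem gateaux_derivative_fractional_cost
    (a b : ℝ) (hab : a < b) (d m : ℕ) (hd : 0 < d) (hm : 0 < m)
    (α : ℝ) (hα0 : 0 < α) (hα1 : α ≤ 1)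
    (A : EuclideanSpace ℝ (Fin d))
    (f : EuclideanSpace ℝ (Fin d) → EuclideanSpace ℝ (Fin m) → ℝ → EuclideanSpace ℝ (Fin d))
    (hf : ContDiffOn ℝ 2
      (fun p : EuclideanSpace ℝ (Fin d) × EuclideanSpace ℝ (Fin m) × ℝ => f p.1 p.2.1 p.2.2)
      (univ ×ˢ univ ×ˢ Icc a b))
    (M : ℝ) (hM : 0 ≤ M)
    (hlip : ∀ x₁ x₂ : EuclideanSpace ℝ (Fin d), ∀ v : EuclideanSpace ℝ (Fin m), ∀ t ∈ Icc a b,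
      ‖f x₁ v t - f x₂ v t‖ ≤ M * ‖x₁ - x₂‖)
    (L : EuclideanSpace ℝ (Fin d) → EuclideanSpace ℝ (Fin m) → ℝ → ℝ)
    (hL : ContDiffOn ℝ 2
      (fun p : EuclideanSpace ℝ (Fin d) × EuclideanSpace ℝ (Fin m) × ℝ => L p.1 p.2.1 p.2.2)
      (univ ×ˢ univ ×ˢ Icc a b))
    -- the partial differentials of `f` and `L` with respect to their first and second variables
    (fx : EuclideanSpace ℝ (Fin d) → EuclideanSpace ℝ (Fin m) → ℝ →
      (EuclideanSpace ℝ (Fin d) →L[ℝ] EuclideanSpace ℝ (Fin d)))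
    (fv : EuclideanSpace ℝ (Fin d) → EuclideanSpace ℝ (Fin m) → ℝ →
      (EuclideanSpace ℝ (Fin m) →L[ℝ] EuclideanSpace ℝ (Fin d)))
    (hfx : ∀ x v, ∀ t ∈ Icc a b, HasFDerivAt (fun y => f y v t) (fx x v t) x)
    (hfv : ∀ x v, ∀ t ∈ Icc a b, HasFDerivAt (fun w => f x w t) (fv x v t) v)
    (Lx : EuclideanSpace ℝ (Fin d) → EuclideanSpace ℝ (Fin m) → ℝ →
      (EuclideanSpace ℝ (Fin d) →L[ℝ] ℝ))
    (Lv : EuclideanSpace ℝ (Fin d) → EuclideanSpace ℝ (Fin m) → ℝ →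
      (EuclideanSpace ℝ (Fin m) →L[ℝ] ℝ))
    (hLx : ∀ x v, ∀ t ∈ Icc a b, HasFDerivAt (fun y => L y v t) (Lx x v t) x)
    (hLv : ∀ x v, ∀ t ∈ Icc a b, HasFDerivAt (fun w => L x w t) (Lv x v t) v)
    (u ub : ℝ → EuclideanSpace ℝ (Fin m))
    (hu : ContinuousOn u (Icc a b)) (hub : ContinuousOn ub (Icc a b))
    (Q : ℝ → ℝ → EuclideanSpace ℝ (Fin d))
    (hQc : ∀ ε : ℝ, ContinuousOn (Q ε) (Icc a b))
    (hQ : ∀ ε : ℝ, ∀ t ∈ Icc a b,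
      Q ε t = A + Ileft a α (fun s => f (Q ε s) (u s + ε • ub s) s) t)
    (qb : ℝ → EuclideanSpace ℝ (Fin d)) (hqbc : ContinuousOn qb (Icc a b))
    (hqb : ∀ t ∈ Icc a b,
      qb t = Ileft a α
        (fun s => fx (Q 0 s) (u s) s (qb s) + fv (Q 0 s) (u s) s (ub s)) t) :
    Tendsto (fun ε : ℝ => ε⁻¹ *
        ((∫ t in a..b, L (Q ε t) (u t + ε • ub t) t) - ∫ t in a..b, L (Q 0 t) (u t) t))
      (𝓝[≠] 0)
      (𝓝 (∫ t in a..b, Lx (Q 0 t) (u t) t (qb t) + Lv (Q 0 t) (u t) t (ub t))) := by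
  have hf1 := hf.of_le (one_le_two : (1 : WithTop ℕ∞) ≤ 2)
  have hL1 := hL.of_le (one_le_two : (1 : WithTop ℕ∞) ≤ 2)
  have hQ0c := hQc 0
  obtain ⟨C, hC0, hC⟩ := exists_fractional_gronwall a b hα0 hM
  have hfc := continuousOn_partial_apply_add hab hf1 hfx hfv hQ0c hu hqbc hub
  have hLc := continuousOn_partial_apply_add hab hL1 hLx hLv hQ0c hu hqbc hub
  have hcu : ∀ ε : ℝ, ContinuousOn (fun s => u s + ε • ub s) (Icc a b) := fun ε => by fun_prop
  have hfQ : ∀ ε : ℝ, ContinuousOn (fun s => f (Q ε s) (u s + ε • ub s) s) (Icc a b) :=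
    fun ε => continuousOn_comp_curve hf.continuousOn (hQc ε) (hcu ε)
  have hLQ : ∀ ε : ℝ, ContinuousOn (fun s => L (Q ε s) (u s + ε • ub s) s) (Icc a b) :=
    fun ε => continuousOn_comp_curve hL.continuousOn (hQc ε) (hcu ε)
  have hR : ∀ η > 0, ∀ᶠ ε in 𝓝 (0 : ℝ), ∀ t ∈ Icc a b,
      ‖Q ε t - Q 0 t - ε • qb t‖ ≤ η * |ε| := by
    intro η hη
    have hlin := eventually_norm_sub_linearization_le hab hf1 hfx hfv hQ0c hu hqbc hub
      (z := fun ε t => Q 0 t + ε • qb t)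
      (fun η hη => .of_forall fun ε t _ => by simpa using by positivity)
      (η := η / C) (by positivity)
    filter_upwards [hlin] with ε hε t ht
    have hcR : ContinuousOn (fun s => ‖Q ε s - Q 0 s - ε • qb s‖) (Icc a b) := by
      have := hQc ε
      fun_prop
    refine (hC (fun s => ‖Q ε s - Q 0 s - ε • qb s‖) (η / C * |ε|) (by positivity) hcR
      (fun _ _ => norm_nonneg _) (fun t ht => ?_) t ht).trans_eq (by field_simp)
    have hsub : Icc a t ⊆ Icc a b := Icc_subset_Icc_right ht.2
    have h0 : ContinuousOn (fun s => f (Q 0 s) (u s) s) (Icc a b) := by simpa using hfQ 0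
    have heq : Q ε t - Q 0 t - ε • qb t = Ileft a α (fun s =>
        f (Q ε s) (u s + ε • ub s) s - f (Q 0 s) (u s) s -
          ε • (fx (Q 0 s) (u s) s (qb s) + fv (Q 0 s) (u s) s (ub s))) t := by
      rw [Ileft_sub hα0 ht.1 (((hfQ ε).fun_sub h0).mono hsub)
          ((hfc.fun_const_smul ε).mono hsub),
        Ileft_sub hα0 ht.1 ((hfQ ε).mono hsub) (h0.mono hsub), Ileft_const_smul, ← hqb t ht,
        hQ ε t ht, hQ 0 t ht]
      simp
    refine (congrArg norm heq).trans_le (norm_Ileft_le hα0 ht.1 ?_ fun s hs => ?_)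
    · exact ((hcR.const_mul M).add continuousOn_const).mono hsub
    · have h1 := hlip (Q ε s) (Q 0 s + ε • qb s) (u s + ε • ub s) s (hsub hs)
      have h2 := norm_add_le_of_le h1 (hε s (hsub hs))
      rw [← sub_sub] at h2
      convert! h2 using 2
      abel
  rw [Metric.tendsto_nhds]
  intro η hη
  have hba : 0 < b - a := sub_pos.2 hab
  have hlin := eventually_norm_sub_linearization_le hab hL1 hLx hLv hQ0c hu hqbc hub hR
    (η := η / (2 * (b - a))) (by positivity)
  filter_upwards [hlin.filter_mono nhdsWithin_le_nhds,
    self_mem_nhdsWithin] with ε hε hε0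
  have hε0 : ε ≠ 0 := hε0
  have hint : ∀ {g : ℝ → ℝ}, ContinuousOn g (Icc a b) → IntervalIntegrable g volume a b :=
    fun hg => hg.intervalIntegrable_of_Icc hab.le
  have hL0 : ContinuousOn (fun s => L (Q 0 s) (u s) s) (Icc a b) := by simpa using hLQ 0
  have hsplit : (∫ t in a..b, L (Q ε t) (u t + ε • ub t) t) - (∫ t in a..b, L (Q 0 t) (u t) t) -
      ε * ∫ t in a..b, Lx (Q 0 t) (u t) t (qb t) + Lv (Q 0 t) (u t) t (ub t) =
      ∫ t in a..b, (L (Q ε t) (u t + ε • ub t) t - L (Q 0 t) (u t) t -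
        ε • (Lx (Q 0 t) (u t) t (qb t) + Lv (Q 0 t) (u t) t (ub t))) := by
    rw [intervalIntegral.integral_sub (hint ((hLQ ε).fun_sub hL0))
      (hint (hLc.fun_const_smul ε)),
      intervalIntegral.integral_sub (hint (hLQ ε)) (hint hL0), intervalIntegral.integral_smul,
      smul_eq_mul]
  have hnorm := intervalIntegral.norm_integral_le_of_norm_le_const
    (fun t ht => hε t (uIcc_of_le hab.le ▸ uIoc_subset_uIcc ht))
  rw [← hsplit, abs_of_pos hba, Real.norm_eq_abs] at hnorm
  rw [Real.dist_eq, ← mul_lt_mul_iff_right₀ (abs_pos.2 hε0), ← abs_mul, mul_sub,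
    mul_inv_cancel_left₀ hε0]
  refine hnorm.trans_lt ?_
  have : η / (2 * (b - a)) * |ε| * (b - a) = |ε| * η / 2 := by field_simp
  rw [this]
  linarith [mul_pos (abs_pos.2 hε0) hη]
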